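/- Let X₁,…,X_k (k ≥ 1) be independent gamma random variables each with density e^{−x} on (0,∞). Then for every integer n ≥ 0, E[(X₁+2X₂+⋯+kX_k−k)ⁿ] = ∑_{m=0}^{n} S₂(m+k,k) · m! · C(n,m) · (−1)^{n−m} · k^{n−m}; that is, ∫_{(0,∞)^k} (x₁+2x₂+⋯+kx_k−k)ⁿ e^{−(x₁+⋯+x_k)} dx₁⋯dx_k = ∑_{m=0}^{n} S₂(m+k,k) m! C(n,m) (−1)^{n−m} k^{n−m}. -/

import Mathlib

open MeasureTheory Finset

/-- Stirling numbers of the second kind: `S₂(n,k) = (1/k!) ∑_{l=0}^k (−1)^{k−l} C(k,l) lⁿ`. -/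
noncomputable def S2 (n k : ℕ) : ℝ :=
  (Nat.factorial k : ℝ)⁻¹ *
    ∑ l ∈ Finset.range (k + 1), (-1 : ℝ) ^ (k - l) * (k.choose l) * (l : ℝ) ^ n

theorem factorial_mul_S2 (n k : ℕ) :
    (k.factorial : ℝ) * S2 n k =
      ∑ l ∈ Finset.range (k + 1), (-1 : ℝ) ^ (k - l) * (k.choose l) * (l : ℝ) ^ n := by
  rw [S2, ← mul_assoc, mul_inv_cancel₀ (by positivity), one_mul]

theorem S2_zero_right (n : ℕ) : S2 n 0 = 0 ^ n := by
  simp [S2]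

theorem S2_zero_left_succ (k : ℕ) : S2 0 (k + 1) = 0 := by
  have h := add_pow (1 : ℝ) (-1) (k + 1)
  simp only [add_neg_cancel, one_pow, one_mul, ne_eq, Nat.succ_ne_zero, not_false_eq_true,
    zero_pow] at h
  simp [S2, ← h]

theorem S2_succ_succ (n k : ℕ) :
    S2 (n + 1) (k + 1) = (k + 1) * S2 n (k + 1) + S2 n k := by
  have hf : ((k + 1).factorial : ℝ) ≠ 0 := by positivity
  have hk := factorial_mul_S2 n k
  have hk1 := factorial_mul_S2 n (k + 1)
  refine mul_left_cancel₀ hf ?_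
  rw [factorial_mul_S2, mul_add, mul_left_comm, hk1, Nat.factorial_succ, Nat.cast_mul, mul_assoc,
    hk, Nat.cast_succ, ← mul_add, Finset.sum_range_succ _ (k + 1), Finset.sum_range_succ _ (k + 1),
    add_right_comm, ← Finset.sum_add_distrib, mul_add, Finset.mul_sum]
  congr 1
  · refine Finset.sum_congr rfl fun l hl => ?_
    have hl : l ≤ k := Nat.lt_succ_iff.mp (Finset.mem_range.mp hl)
    have hc : ((k + 1).choose l : ℝ) * ((k : ℝ) + 1 - l) = (k + 1) * k.choose l := by
      have := Nat.choose_mul_succ_eq k l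
      have h2 : ((k + 1 - l : ℕ) : ℝ) = (k : ℝ) + 1 - l := by
        rw [Nat.cast_sub (by omega)]; push_cast; ring
      rw [← h2, mul_comm ((k : ℝ) + 1)]
      exact_mod_cast this.symm
    rw [show k + 1 - l = (k - l) + 1 by omega]
    linear_combination (-1 : ℝ) ^ (k - l) * (l : ℝ) ^ n * hc
  · simp [pow_succ']

theorem S2_eq_zero_of_lt {n k : ℕ} (h : n < k) : S2 n k = 0 := by
  induction n generalizing k with
  | zero =>
    obtain ⟨k, rfl⟩ := Nat.exists_eq_succ_of_ne_zero h.ne'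
    exact S2_zero_left_succ k
  | succ n ih =>
    obtain ⟨k, rfl⟩ := Nat.exists_eq_succ_of_ne_zero (by omega : k ≠ 0)
    rw [Nat.succ_eq_add_one, S2_succ_succ, ih (by omega), ih (by omega)]
    simp

theorem S2_add_succ_eq_sum (m k : ℕ) :
    S2 (m + (k + 1)) (k + 1) =
      ∑ j ∈ Finset.range (m + 1), S2 (j + k) k * ((k : ℝ) + 1) ^ (m - j) := by
  induction m with
  | zero => simp [S2_succ_succ, S2_eq_zero_of_lt]
  | succ m ih =>
    rw [show m + 1 + (k + 1) = m + (k + 1) + 1 by ring, S2_succ_succ, ih,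
      Finset.sum_range_succ _ (m + 1), Finset.mul_sum]
    congr 1
    · refine Finset.sum_congr rfl fun j hj => ?_
      rw [show m + 1 - j = (m - j) + 1 by have := Finset.mem_range.mp hj; omega]
      ring
    · rw [Nat.sub_self, pow_zero, mul_one, show m + (k + 1) = m + 1 + k by ring]

theorem integrable_pow_mul_exp_neg (n : ℕ) :
    Integrable (fun x : ℝ => x ^ n * Real.exp (-x)) (volume.restrict (Set.Ioi 0)) := by
  have := Real.GammaIntegral_convergent (s := n + 1) (by positivity)
  simpa [IntegrableOn, mul_comm] using this

theorem integral_pow_mul_exp_neg (n : ℕ) :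
    ∫ x in Set.Ioi (0 : ℝ), x ^ n * Real.exp (-x) = n.factorial := by
  rw [← Real.Gamma_nat_eq_factorial, Real.Gamma_eq_integral (by positivity)]
  simp [mul_comm]

theorem integrable_and_integral_weighted_sum_pow (k m : ℕ) :
    Integrable (fun x : Fin k → ℝ =>
        (∑ i, ((i.val : ℝ) + 1) * x i) ^ m * Real.exp (-∑ i, x i))
      (Measure.pi fun _ => volume.restrict (Set.Ioi 0)) ∧
    ∫ x : Fin k → ℝ, (∑ i, ((i.val : ℝ) + 1) * x i) ^ m * Real.exp (-∑ i, x i)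
      ∂(Measure.pi fun _ => volume.restrict (Set.Ioi 0)) = m.factorial * S2 (m + k) k := by
  induction k generalizing m with
  | zero =>
    refine ⟨by simp, ?_⟩
    rcases m with _ | m <;> simp [S2_zero_right, Measure.real]
  | succ k ih =>
    set μ : Measure ℝ := volume.restrict (Set.Ioi 0)
    have hmp := measurePreserving_piFinSuccAbove (fun _ : Fin (k + 1) => μ) (Fin.last k)
    have hemb := (MeasurableEquiv.piFinSuccAbove (fun _ : Fin (k + 1) => ℝ)
      (Fin.last k)).measurableEmbedding
    let G : ℕ → ℝ × (Fin k → ℝ) → ℝ := fun j z =>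
      (((k : ℝ) + 1) ^ (m - j) * m.choose j) *
        ((z.1 ^ (m - j) * Real.exp (-z.1)) *
          ((∑ i, ((i.val : ℝ) + 1) * z.2 i) ^ j * Real.exp (-∑ i, z.2 i)))
    have hG : ∀ j, Integrable (G j) (μ.prod (Measure.pi fun _ => μ)) := fun j =>
      ((integrable_pow_mul_exp_neg (m - j)).mul_prod (ih j).1).const_mul _
    have hfun : (fun x : Fin (k + 1) → ℝ =>
        (∑ i, ((i.val : ℝ) + 1) * x i) ^ m * Real.exp (-∑ i, x i)) =
        (fun z => ∑ j ∈ Finset.range (m + 1), G j z) ∘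
          (MeasurableEquiv.piFinSuccAbove (fun _ : Fin (k + 1) => ℝ) (Fin.last k)) := by
      funext x
      have h1 : (MeasurableEquiv.piFinSuccAbove (fun _ : Fin (k + 1) => ℝ) (Fin.last k)) x =
          (x (Fin.last k), fun i : Fin k => x i.castSucc) := by
        ext i
        · rfl
        · simp [MeasurableEquiv.piFinSuccAbove, Fin.init]
      simp only [Function.comp_apply, h1, Fin.sum_univ_castSucc, Fin.val_castSucc, Fin.val_last, G,
        neg_add, Real.exp_add]
      rw [add_pow, Finset.sum_mul]
      exact Finset.sum_congr rfl fun j _ => by rw [mul_pow]; ring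
    rw [hfun]
    refine ⟨(hmp.integrable_comp_emb hemb).2 (integrable_finsetSum _ fun j _ => hG j), ?_⟩
    refine (hmp.integral_comp hemb fun z => ∑ j ∈ Finset.range (m + 1), G j z).trans ?_
    rw [integral_finsetSum _ fun j _ => hG j, S2_add_succ_eq_sum, Finset.mul_sum]
    refine Finset.sum_congr rfl fun j hj => ?_
    have hj : j ≤ m := Nat.lt_succ_iff.mp (Finset.mem_range.mp hj)
    have hint : ∫ z, G j z ∂(μ.prod (Measure.pi fun _ => μ)) =
        (((k : ℝ) + 1) ^ (m - j) * m.choose j) *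
          ((m - j).factorial * (j.factorial * S2 (j + k) k)) := by
      rw [← integral_pow_mul_exp_neg, ← (ih j).2, ← integral_prod_mul, ← integral_const_mul]
    have hc : (m.choose j : ℝ) * j.factorial * (m - j).factorial = m.factorial := by
      exact_mod_cast Nat.choose_mul_factorial_mul_factorial hj
    refine hint.trans ?_
    linear_combination ((k : ℝ) + 1) ^ (m - j) * S2 (j + k) k * hc

/-- For `X₁,…,X_k` (`k ≥ 1`) independent gamma random variables with density `e^{−x}` on
`(0,∞)` and `n ≥ 0`:
`E[(X₁+2X₂+⋯+kX_k−k)ⁿ] = ∑_{m=0}^n S₂(m+k,k) m! C(n,m) (−1)^{n−m} k^{n−m}`. -/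
theorem stmt12 (k : ℕ) (hk : 1 ≤ k) (n : ℕ) :
    ∫ x in Set.univ.pi (fun _ : Fin k => Set.Ioi (0 : ℝ)),
        ((∑ i, ((i.val : ℝ) + 1) * x i) - k) ^ n * Real.exp (-∑ i, x i)
      = ∑ m ∈ Finset.range (n + 1),
          S2 (m + k) k * (Nat.factorial m : ℝ) * (n.choose m : ℝ) * (-1 : ℝ) ^ (n - m) *
            (k : ℝ) ^ (n - m) := by
  rw [volume_pi, Measure.restrict_pi_pi]
  have hexp : ∀ x : Fin k → ℝ,
      ((∑ i, ((i.val : ℝ) + 1) * x i) - k) ^ n * Real.exp (-∑ i, x i) =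
        ∑ m ∈ Finset.range (n + 1), ((n.choose m : ℝ) * (-1) ^ (n - m) * (k : ℝ) ^ (n - m)) *
          ((∑ i, ((i.val : ℝ) + 1) * x i) ^ m * Real.exp (-∑ i, x i)) := fun x => by
    rw [sub_eq_add_neg, add_pow, Finset.sum_mul]
    exact Finset.sum_congr rfl fun m _ => by rw [neg_pow (k : ℝ)]; ring
  simp_rw [hexp]
  rw [integral_finsetSum _ fun m _ =>
    (integrable_and_integral_weighted_sum_pow k m).1.const_mul _]
  refine Finset.sum_congr rfl fun m _ => ?_
  rw [integral_const_mul, (integrable_and_integral_weighted_sum_pow k m).2]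
  ring
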